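/- Let k be a field with algebraic closure K, A a finite-dimensional k-algebra, and Q, M finite-dimensional A-modules. Then the relative dominant dimension is stable under field extension to the algebraic closure: (K ⊗_k Q)-domdim_{K ⊗_k A}(K ⊗_k M) = Q-domdim_A M. -/

import Mathlib

universe u
open Function TensorProduct

namespace RelDom

section


variable (R : Type u) [CommRing R] (A : Type u) [Ring A] [Algebra R A]

/-- `M` is a direct summand of a finite direct sum of copies of `T`, i.e. `M ∈ add T`. -/
def InAdd (T : Type u) [AddCommGroup T] [Module A T]
    (M : Type u) [AddCommGroup M] [Module A M] : Prop :=
  ∃ (n : ℕ) (i : M →ₗ[A] (Fin n → T)) (p : (Fin n → T) →ₗ[A] M), ∀ m, p (i m) = m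

/-- `f` is an `(A,R)`-monomorphism : an injective `A`-linear map admitting an
`R`-linear retraction (the `R`-action being the one through `algebraMap R A`). -/
def RSplitMono {M N : Type u} [AddCommGroup M] [Module A M]
    [AddCommGroup N] [Module A N] (f : M →ₗ[A] N) : Prop :=
  Injective f ∧ ∃ r : N →+ M,
    (∀ (s : R) (x : N), r (algebraMap R A s • x) = algebraMap R A s • r x) ∧
    ∀ m, r (f m) = m

/-- `f` is an `(A,R)`-epimorphism : a surjective `A`-linear map admitting an
`R`-linear section. -/
def RSplitEpi {M N : Type u} [AddCommGroup M] [Module A M]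
    [AddCommGroup N] [Module A N] (f : M →ₗ[A] N) : Prop :=
  Surjective f ∧ ∃ s : N →+ M,
    (∀ (c : R) (x : N), s (algebraMap R A c • x) = algebraMap R A c • s x) ∧
    ∀ x, f (s x) = x

/-- A submodule `p ≤ N` is an `R`-direct summand of `N`. -/
def RSummand {N : Type u} [AddCommGroup N] [Module A N] (p : Submodule A N) : Prop :=
  ∃ r : N →+ p, (∀ (c : R) (x : N), r (algebraMap R A c • x) = algebraMap R A c • r x) ∧
    ∀ x : p, r x = x

/-- `Q`-relative dominant dimension of `M` is at least `n`:
there is an `(A,R)`-exact sequence `0 → M → T₁ → ⋯ → Tₙ` with all `Tᵢ ∈ add Q`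
which stays exact under `Hom_A(-, Q)`. -/
def DomdimGE (Q : Type u) [AddCommGroup Q] [Module A Q] :
    ℕ → ModuleCat.{u} A → Prop
  | 0, _ => True
  | n + 1, M =>
      ∃ (T : ModuleCat.{u} A) (_ : InAdd A Q T) (f : M →ₗ[A] T),
        RSplitMono R A f ∧
        (∀ g : (M : Type u) →ₗ[A] Q, ∃ h : (T : Type u) →ₗ[A] Q, ∀ m, h (f m) = g m) ∧
        DomdimGE Q n (ModuleCat.of A ((T : Type u) ⧸ LinearMap.range f))

/-- `Q`-relative codominant dimension of `M` is at least `n`. -/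
def CodomdimGE (Q : Type u) [AddCommGroup Q] [Module A Q] :
    ℕ → ModuleCat.{u} A → Prop
  | 0, _ => True
  | n + 1, M =>
      ∃ (T : ModuleCat.{u} A) (_ : InAdd A Q T) (f : T →ₗ[A] M),
        RSplitEpi R A f ∧
        (∀ g : Q →ₗ[A] (M : Type u), ∃ h : Q →ₗ[A] (T : Type u), ∀ q, f (h q) = g q) ∧
        CodomdimGE Q n (ModuleCat.of A (LinearMap.ker f))

/-- The relative dominant dimension of `M` with respect to `Q`, as a value in `ℕ∞`. -/
noncomputable def Domdim (Q : Type u) [AddCommGroup Q] [Module A Q]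
    (M : ModuleCat.{u} A) : ℕ∞ :=
  ⨆ (n : ℕ) (_ : DomdimGE R A Q n M), (n : ℕ∞)

/-- The relative codominant dimension of `M` with respect to `Q`, as a value in `ℕ∞`. -/
noncomputable def Codomdim (Q : Type u) [AddCommGroup Q] [Module A Q]
    (M : ModuleCat.{u} A) : ℕ∞ :=
  ⨆ (n : ℕ) (_ : CodomdimGE R A Q n M), (n : ℕ∞)


end

section


variable (R : Type u) [CommRing R] (A : Type u) [Ring A] [Algebra R A]

section Dual

variable (S : Type u) [Ring S]
variable (M : Type u) [AddCommGroup M] [Module R M] [Module S M] [SMulCommClass S R M]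

/-- scalar action of `a : S` as an `R`-linear endomorphism. -/
def smulEnd (a : S) : M →ₗ[R] M where
  toFun m := a • m
  map_add' := smul_add a
  map_smul' r m := smul_comm a r m

/-- The standard duality `D = Hom_R(-, R)` turns a left `S`-module into a right
`S`-module, i.e. a module over `Sᵐᵒᵖ`. -/
instance dualModule : Module Sᵐᵒᵖ (M →ₗ[R] R) where
  smul a f := f ∘ₗ smulEnd R S M a.unop
  one_smul f := LinearMap.ext fun m => by
    show f ((1 : Sᵐᵒᵖ).unop • m) = f m
    simp
  mul_smul a b f := LinearMap.ext fun m => by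
    show f ((a * b).unop • m) = f (b.unop • a.unop • m)
    rw [MulOpposite.unop_mul, mul_smul]
  smul_zero a := LinearMap.ext fun m => rfl
  smul_add a f g := LinearMap.ext fun m => rfl
  add_smul a b f := LinearMap.ext fun m => by
    show f ((a + b).unop • m) = f (a.unop • m) + f (b.unop • m)
    rw [MulOpposite.unop_add, add_smul, map_add]
  zero_smul f := LinearMap.ext fun m => by
    show f ((0 : Sᵐᵒᵖ).unop • m) = 0
    rw [MulOpposite.unop_zero, zero_smul, map_zero]

lemma dual_smul_apply (a : Sᵐᵒᵖ) (f : M →ₗ[R] R) (m : M) :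
    (a • f) m = f (a.unop • m) := rfl

end Dual

section Coind

/-- The left `A`-module structure on `Hom_R(A, R)`, the dual of the *right*
regular module: `(a • f) x = f (x * a)`. -/
instance coindModule : Module A (A →ₗ[R] R) where
  smul a f := f ∘ₗ
    { toFun := fun x => x * a
      map_add' := fun x y => add_mul x y a
      map_smul' := fun r x => smul_mul_assoc r x a }
  one_smul f := LinearMap.ext fun x => by
    show f (x * 1) = f x
    rw [mul_one]
  mul_smul a b f := LinearMap.ext fun x => by
    show f (x * (a * b)) = f ((x * a) * b)
    rw [mul_assoc]
  smul_zero a := LinearMap.ext fun x => rfl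
  smul_add a f g := LinearMap.ext fun x => rfl
  add_smul a b f := LinearMap.ext fun x => by
    show f (x * (a + b)) = f (x * a) + f (x * b)
    rw [mul_add, map_add]
  zero_smul f := LinearMap.ext fun x => by
    show f (x * 0) = 0
    rw [mul_zero, map_zero]

lemma coind_smul_apply (a : A) (f : A →ₗ[R] R) (x : A) :
    (a • f) x = f (x * a) := rfl

end Coind

section TensorOver

variable (X : Type u) [AddCommGroup X] [Module R X] [Module Aᵐᵒᵖ X]
variable (Y : Type u) [AddCommGroup Y] [Module R Y] [Module A Y]

/-- The balancing relations for the tensor product over the (possibly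
noncommutative) `R`-algebra `A`. -/
def balanceRel : Set (X ⊗[R] Y) :=
  {z | ∃ (x : X) (a : A) (y : Y),
    z = (MulOpposite.op a • x) ⊗ₜ[R] y - x ⊗ₜ[R] (a • y)}

/-- The tensor product `X ⊗_A Y` of a right `A`-module `X` and a left `A`-module `Y`
over the `R`-algebra `A`, realized as a quotient of `X ⊗[R] Y`. -/
abbrev TensorOver : Type u :=
  (X ⊗[R] Y) ⧸ Submodule.span R (balanceRel R A X Y)

end TensorOver


end

section


section BaseChange

variable (R : Type u) [CommRing R] (S : Type u) [CommRing S] [Algebra R S]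
variable (A : Type u) [Ring A] [Algebra R A]
variable (M : Type u) [AddCommGroup M] [Module R M] [Module A M] [SMulCommClass A R M]

/-- The base change `S ⊗[R] M` of the `A`-module `M` along `R → S`, as a type
synonym carrying an action of `S`, of `A` and of `S ⊗[R] A`. -/
def BC : Type u := S ⊗[R] M

noncomputable instance : AddCommGroup (BC R S M) := inferInstanceAs (AddCommGroup (S ⊗[R] M))

/-- the canonical inclusion-of-elements map `S ⊗[R] M → BC R S M` -/
def toBC (x : S ⊗[R] M) : BC R S M := x

/-- The `A`-module structure on the base change `S ⊗[R] M` (acting through the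
second factor). -/
noncomputable instance bcModule : Module A (BC R S M) where
  smul a x := toBC R S M (LinearMap.lTensor S (smulEnd R A M a) x)
  one_smul x := by
    show LinearMap.lTensor S (smulEnd R A M 1) x = x
    have h : smulEnd R A M (1 : A) = LinearMap.id := by ext m; simp [smulEnd]
    rw [h, LinearMap.lTensor_id]; rfl
  mul_smul a b x := by
    show LinearMap.lTensor S (smulEnd R A M (a * b)) x =
      LinearMap.lTensor S (smulEnd R A M a) (LinearMap.lTensor S (smulEnd R A M b) x)
    have h : smulEnd R A M (a * b) = smulEnd R A M a ∘ₗ smulEnd R A M b := by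
      ext m; simp [smulEnd, mul_smul]
    rw [h, LinearMap.lTensor_comp]; rfl
  smul_zero a := map_zero (LinearMap.lTensor S (smulEnd R A M a))
  smul_add a x y := map_add (LinearMap.lTensor S (smulEnd R A M a)) x y
  add_smul a b x := by
    show LinearMap.lTensor S (smulEnd R A M (a + b)) x = _
    have h : smulEnd R A M (a + b) = smulEnd R A M a + smulEnd R A M b := by
      ext m; simp [smulEnd, add_smul]
    rw [h, LinearMap.lTensor_add]; rfl
  zero_smul x := by
    show LinearMap.lTensor S (smulEnd R A M 0) x = 0
    have h : smulEnd R A M (0 : A) = 0 := by ext m; simp [smulEnd]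
    rw [h, LinearMap.lTensor_zero]; rfl

noncomputable instance (priority := 5000) : Module R (BC R S M) :=
  inferInstanceAs (Module R (S ⊗[R] M))
noncomputable instance (priority := 5000) : Module S (BC R S M) :=
  inferInstanceAs (Module S (S ⊗[R] M))
noncomputable instance (priority := 5000) : IsScalarTower R S (BC R S M) :=
  inferInstanceAs (IsScalarTower R S (S ⊗[R] M))

lemma bc_smul_tmul (a : A) (s : S) (m : M) :
    a • (toBC R S M (s ⊗ₜ[R] m)) = toBC R S M (s ⊗ₜ[R] (a • m)) := rfl

lemma bc_s_smul (s : S) (x : S ⊗[R] M) :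
    s • toBC R S M x = toBC R S M (s • x) := rfl

instance bcTower [IsScalarTower R A M] : IsScalarTower R A (BC R S M) :=
  ⟨fun r a x => by
    show (r • a) • toBC R S M x = r • a • toBC R S M x
    induction x using TensorProduct.induction_on with
    | zero =>
        rw [show toBC R S M 0 = 0 from rfl, smul_zero, smul_zero, smul_zero]
    | tmul s m =>
        rw [bc_smul_tmul, bc_smul_tmul, smul_assoc]
        exact congrArg (toBC R S M) (TensorProduct.tmul_smul r s (a • m))
    | add x y hx hy =>
        rw [show toBC R S M (x + y) = toBC R S M x + toBC R S M y from rfl,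
          smul_add (r • a), hx, hy, smul_add a, smul_add r]⟩

instance bcComm : SMulCommClass S A (BC R S M) :=
  ⟨fun s a x => by
    show s • a • toBC R S M x = a • s • toBC R S M x
    induction x using TensorProduct.induction_on with
    | zero =>
        rw [show toBC R S M 0 = 0 from rfl, smul_zero, smul_zero, smul_zero]
    | tmul s' m =>
        rw [bc_smul_tmul, bc_s_smul, bc_s_smul, TensorProduct.smul_tmul',
          TensorProduct.smul_tmul', bc_smul_tmul]
    | add x y hx hy =>
        rw [show toBC R S M (x + y) = toBC R S M x + toBC R S M y from rfl,
          smul_add a (toBC R S M x) (toBC R S M y), smul_add s, hx, hy,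
          smul_add s (toBC R S M x) (toBC R S M y), smul_add a]⟩

/-- The `S ⊗[R] A`-module structure on the base change `S ⊗[R] M`. -/
noncomputable instance bcBig [IsScalarTower R A M] : Module (S ⊗[R] A) (BC R S M) :=
  TensorProduct.Algebra.module

end BaseChange


end

end RelDom

open RelDom Function TensorProduct



namespace RelDomAux

section Stable

variable (R : Type u) [Field R] (A : Type u) [Ring A] [Algebra R A]
variable (Q : Type u) [AddCommGroup Q] [Module A Q]

/-- Over a field every injective `A`-linear map is an `(A,R)`-monomorphism. -/
lemma rsplit_of_injective {M N : Type u} [AddCommGroup M] [Module A M]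
    [AddCommGroup N] [Module A N] (f : M →ₗ[A] N) (hf : Injective f) :
    RSplitMono R A f := by
  refine ⟨hf, ?_⟩
  let _ : Module R M := Module.compHom M (algebraMap R A)
  let _ : Module R N := Module.compHom N (algebraMap R A)
  let f' : M →ₗ[R] N :=
    { toFun := f
      map_add' := f.map_add
      map_smul' := fun r m => f.map_smul (algebraMap R A r) m }
  obtain ⟨r, hr⟩ := f'.exists_leftInverse_of_injective (LinearMap.ker_eq_bot.2 hf)
  exact ⟨r.toAddMonoidHom, fun s x => r.map_smul s x, fun m => LinearMap.congr_fun hr m⟩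

/-- `f : M → T` is a left `Q`-approximation. -/
def App {M T : Type u} [AddCommGroup M] [Module A M] [AddCommGroup T] [Module A T]
    (f : M →ₗ[A] T) : Prop :=
  ∀ g : M →ₗ[A] Q, ∃ h : T →ₗ[A] Q, ∀ m, h (f m) = g m

variable {A Q}

lemma App.extend {M T U : Type u} [AddCommGroup M] [Module A M] [AddCommGroup T] [Module A T]
    [AddCommGroup U] [Module A U] {f : M →ₗ[A] T} (hf : App A Q f) (hU : InAdd A Q U)
    (g : M →ₗ[A] U) : ∃ h : T →ₗ[A] U, ∀ m, h (f m) = g m := by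
  obtain ⟨n, i, p, hip⟩ := hU
  choose h hh using fun j : Fin n => hf (LinearMap.proj j ∘ₗ i ∘ₗ g)
  refine ⟨p ∘ₗ LinearMap.pi h, fun m => ?_⟩
  rw [LinearMap.comp_apply, show LinearMap.pi h (f m) = i (g m) from funext fun j => hh j m, hip]

lemma inAdd_prod {T U : Type u} [AddCommGroup T] [Module A T]
    [AddCommGroup U] [Module A U] (hT : InAdd A Q T) (hU : InAdd A Q U) : InAdd A Q (T × U) := by
  obtain ⟨n, i, p, hip⟩ := hT
  obtain ⟨n', i', p', hip'⟩ := hU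
  let e : ((Fin n → Q) × (Fin n' → Q)) ≃ₗ[A] (Fin (n + n') → Q) :=
    (LinearEquiv.sumArrowLequivProdArrow (Fin n) (Fin n') A Q).symm ≪≫ₗ
      LinearEquiv.funCongrLeft A Q finSumFinEquiv.symm
  refine ⟨n + n', e.toLinearMap ∘ₗ i.prodMap i', p.prodMap p' ∘ₗ e.symm.toLinearMap, ?_⟩
  rintro ⟨x, y⟩
  simp [hip, hip']

/-- `X` is, up to maps through `add Q`, a retract of `Y`. -/
def StRet (A : Type u) [Ring A] (Q : Type u) [AddCommGroup Q] [Module A Q]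
    (X Y : Type u) [AddCommGroup X] [Module A X] [AddCommGroup Y] [Module A Y] : Prop :=
  ∃ (T : ModuleCat.{u} A) (_ : InAdd A Q T) (i : X →ₗ[A] Y) (p : Y →ₗ[A] X)
    (i' : X →ₗ[A] T) (p' : T →ₗ[A] X), ∀ x, p (i x) + p' (i' x) = x

lemma stRet_of_equiv {X Y : Type u} [AddCommGroup X] [Module A X] [AddCommGroup Y] [Module A Y]
    (e : X ≃ₗ[A] Y) : StRet A Q X Y :=
  ⟨ModuleCat.of A (Fin 0 → Q), ⟨0, LinearMap.id, LinearMap.id, fun _ => rfl⟩,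
    e.toLinearMap, e.symm.toLinearMap, 0, 0, fun x => by simp⟩

lemma stRet_quot {X Y U T : Type u} [AddCommGroup X] [Module A X] [AddCommGroup Y] [Module A Y]
    [AddCommGroup U] [Module A U] [AddCommGroup T] [Module A T]
    (h : StRet A Q X Y) (φ : X →ₗ[A] U) (hφ : App A Q φ) (hU : InAdd A Q U)
    (f : Y →ₗ[A] T) (hf : App A Q f) (hT : InAdd A Q T) :
    StRet A Q (U ⧸ LinearMap.range φ) (T ⧸ LinearMap.range f) := by
  obtain ⟨V, hV, i, p, i', p', hip⟩ := h
  obtain ⟨a, ha⟩ := hφ.extend hT (f ∘ₗ i)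
  obtain ⟨b, hb⟩ := hf.extend hU (φ ∘ₗ p)
  obtain ⟨c, hc⟩ := hφ.extend hV i'
  have ha' : LinearMap.range φ ≤ (LinearMap.range f).comap a := by
    rintro _ ⟨x, rfl⟩
    exact ⟨i x, (ha x).symm⟩
  have hb' : LinearMap.range f ≤ (LinearMap.range φ).comap b := by
    rintro _ ⟨x, rfl⟩
    exact ⟨p x, (hb x).symm⟩
  have hr : LinearMap.range φ ≤
      LinearMap.ker (LinearMap.id - b ∘ₗ a - φ ∘ₗ p' ∘ₗ c : U →ₗ[A] U) := by
    rintro _ ⟨x, rfl⟩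
    have h1 : b (a (φ x)) = φ (p (i x)) := by
      rw [ha]; exact hb _
    have h2 : φ (p' (c (φ x))) = φ (p' (i' x)) := by rw [hc]
    rw [LinearMap.mem_ker]
    simp only [LinearMap.sub_apply, LinearMap.comp_apply, LinearMap.id_apply]
    rw [h1, h2, sub_sub, ← map_add, hip, sub_self]
  refine ⟨ModuleCat.of A U, hU, Submodule.mapQ _ _ a ha', Submodule.mapQ _ _ b hb',
    Submodule.liftQ _ _ hr, Submodule.mkQ _, ?_⟩
  intro x
  obtain ⟨x, rfl⟩ := Submodule.Quotient.mk_surjective _ x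
  have hz : (Submodule.Quotient.mk (φ (p' (c x))) : U ⧸ LinearMap.range φ) = 0 :=
    (Submodule.Quotient.mk_eq_zero _).2 ⟨_, rfl⟩
  simp only [Submodule.mapQ_apply, Submodule.liftQ_apply, Submodule.mkQ_apply,
    LinearMap.sub_apply, LinearMap.comp_apply, LinearMap.id_apply, Submodule.Quotient.mk_sub, hz]
  abel

lemma domdimGE_of_stRet (n : ℕ) : ∀ (X Y : Type u) [AddCommGroup X] [Module A X]
    [AddCommGroup Y] [Module A Y], StRet A Q X Y →
    DomdimGE R A Q n (ModuleCat.of A Y) → DomdimGE R A Q n (ModuleCat.of A X) := by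
  induction n with
  | zero => intros; trivial
  | succ n ih =>
    intro X Y _ _ _ _ h hY
    obtain ⟨T, hT, f, hf, hfa, hC⟩ := hY
    obtain ⟨V, hV, i, p, i', p', hip⟩ := id h
    have hφ : App A Q ((f ∘ₗ i).prod i') := by
      intro g
      obtain ⟨e, he⟩ := hfa (g ∘ₗ p)
      refine ⟨e.coprod (g ∘ₗ p'), fun m => ?_⟩
      have := he (i m)
      simp only [LinearMap.comp_apply] at this
      simp only [LinearMap.coprod_apply, LinearMap.prod_apply, LinearMap.comp_apply]
      rw [← hip m, map_add g, hip m]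
      exact congrArg (· + _) this
    refine ⟨ModuleCat.of A (T × V), inAdd_prod hT hV, (f ∘ₗ i).prod i',
      rsplit_of_injective R A _ ?_, hφ, ?_⟩
    · refine (injective_iff_map_eq_zero _).2 fun x hx => ?_
      have h1 : f (i x) = 0 := congrArg Prod.fst hx
      have h2 : i' x = 0 := congrArg Prod.snd hx
      have h3 : i x = 0 := hf.1 (h1.trans (map_zero f).symm)
      rw [← hip x, h2, h3, map_zero, map_zero, add_zero]
    · exact ih _ _ (stRet_quot h _ hφ (inAdd_prod hT hV) f hfa hT) hC

lemma domdimGE_succ_iff (n : ℕ) {X U : Type u} [AddCommGroup X] [Module A X]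
    [AddCommGroup U] [Module A U] (φ : X →ₗ[A] U) (hφ : App A Q φ) (hU : InAdd A Q U) :
    DomdimGE R A Q (n + 1) (ModuleCat.of A X) ↔
      Injective φ ∧ DomdimGE R A Q n (ModuleCat.of A (U ⧸ LinearMap.range φ)) := by
  constructor
  · rintro ⟨T, hT, f, hf, hfa, hC⟩
    constructor
    · obtain ⟨a, ha⟩ := hφ.extend hT f
      intro x y hxy
      apply hf.1
      rw [← ha, hxy, ha]
    · exact domdimGE_of_stRet R n _ _
        (stRet_quot (stRet_of_equiv (LinearEquiv.refl A X)) φ hφ hU f hfa hT) hC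
  · rintro ⟨hi, hC⟩
    exact ⟨ModuleCat.of A U, hU, φ, rsplit_of_injective R A φ hi, hφ, hC⟩

lemma domdimGE_congr (n : ℕ) {X Y : Type u} [AddCommGroup X] [Module A X]
    [AddCommGroup Y] [Module A Y] (e : X ≃ₗ[A] Y) :
    DomdimGE R A Q n (ModuleCat.of A X) ↔ DomdimGE R A Q n (ModuleCat.of A Y) :=
  ⟨domdimGE_of_stRet R n _ _ (stRet_of_equiv e.symm),
    domdimGE_of_stRet R n _ _ (stRet_of_equiv e)⟩

end Stable

section Base

variable (k : Type u) [Field k] (K : Type u) [Field K] [Algebra k K]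
variable {A : Type u} [Ring A] [Algebra k A]

lemma bc_big_smul {M : Type u} [AddCommGroup M] [Module k M] [Module A M]
    [SMulCommClass A k M] [IsScalarTower k A M] (s c : K) (a : A) (m : M) :
    (s ⊗ₜ[k] a : K ⊗[k] A) • toBC k K M (c ⊗ₜ[k] m) = toBC k K M ((s * c) ⊗ₜ[k] (a • m)) := rfl

/-- Build a `K ⊗ A`-linear map out of a `K`-linear and `A`-linear one. -/
noncomputable def mkBig {M N : Type u} [AddCommGroup M] [Module k M] [Module A M]
    [SMulCommClass A k M] [IsScalarTower k A M] [AddCommGroup N] [Module k N] [Module A N]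
    [SMulCommClass A k N] [IsScalarTower k A N] (F : BC k K M →+ BC k K N)
    (h1 : ∀ (s : K) x, F (s • x) = s • F x) (h2 : ∀ (a : A) x, F (a • x) = a • F x) :
    BC k K M →ₗ[K ⊗[k] A] BC k K N where
  toFun := F
  map_add' := F.map_add
  map_smul' z x := by
    show F (z • x) = z • F x
    induction z using TensorProduct.induction_on with
    | zero => rw [zero_smul, zero_smul, map_zero]
    | tmul s a =>
      have := h1 s (a • x)
      rw [h2] at this
      exact this
    | add z w hz hw => rw [add_smul, add_smul, map_add, hz, hw]

/-- The base change of an `A`-linear map. -/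
noncomputable def bcMap {M N : Type u} [AddCommGroup M] [Module k M] [Module A M]
    [SMulCommClass A k M] [IsScalarTower k A M] [AddCommGroup N] [Module k N] [Module A N]
    [SMulCommClass A k N] [IsScalarTower k A N] (f : M →ₗ[A] N) :
    BC k K M →ₗ[K ⊗[k] A] BC k K N :=
  mkBig k K (M := M) (N := N) ((f.restrictScalars k).baseChange K).toAddMonoidHom
    (fun s x => ((f.restrictScalars k).baseChange K).map_smul s x)
    (fun a x => by
      show LinearMap.lTensor K (f.restrictScalars k) (LinearMap.lTensor K (smulEnd k A M a) x) =
        LinearMap.lTensor K (smulEnd k A N a) (LinearMap.lTensor K (f.restrictScalars k) x)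
      have h : f.restrictScalars k ∘ₗ smulEnd k A M a = smulEnd k A N a ∘ₗ f.restrictScalars k :=
        LinearMap.ext fun m => f.map_smul a m
      have h' := congrArg (LinearMap.lTensor K) h
      rw [LinearMap.lTensor_comp, LinearMap.lTensor_comp] at h'
      exact LinearMap.congr_fun h' x)

/-- Multiplication by a scalar of `K`. -/
noncomputable def scal (M : Type u) [AddCommGroup M] [Module k M] [Module A M]
    [SMulCommClass A k M] [IsScalarTower k A M] (c : K) :
    BC k K M →ₗ[K ⊗[k] A] BC k K M :=
  mkBig k K (M := M) (N := M) (DistribSMul.toAddMonoidHom (BC k K M) c)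
    (fun s x => smul_comm c s x) (fun a x => smul_comm c a x)

variable {M N P : Type u} [AddCommGroup M] [Module k M] [Module A M]
  [SMulCommClass A k M] [IsScalarTower k A M] [AddCommGroup N] [Module k N] [Module A N]
  [SMulCommClass A k N] [IsScalarTower k A N]
  [AddCommGroup P] [Module k P] [Module A P]
  [SMulCommClass A k P] [IsScalarTower k A P]

lemma bcMap_coe (f : M →ₗ[A] N) :
    ⇑(bcMap k K f) = ⇑(LinearMap.lTensor K (f.restrictScalars k)) := rfl

lemma bcMap_tmul (f : M →ₗ[A] N) (c : K) (m : M) :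
    bcMap k K f (toBC k K M (c ⊗ₜ[k] m)) = toBC k K N (c ⊗ₜ[k] f m) := rfl

lemma scal_apply (c : K) (x : BC k K M) : scal k K (A := A) M c x = c • x := rfl

lemma bc_induction {p : BC k K M → Prop} (h0 : p 0)
    (h1 : ∀ (c : K) (m : M), p (toBC k K M (c ⊗ₜ[k] m)))
    (h2 : ∀ x y, p x → p y → p (x + y)) (x : BC k K M) : p x :=
  TensorProduct.induction_on (motive := p) x h0 h1 h2

lemma toBC_eq_smul (c : K) (m : M) :
    toBC k K M (c ⊗ₜ[k] m) = (c ⊗ₜ[k] (1 : A) : K ⊗[k] A) • toBC k K M (1 ⊗ₜ[k] m) := by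
  rw [bc_big_smul, mul_one, one_smul]

/-- Two maps out of the base change agreeing on `1 ⊗ m` agree. -/
lemma big_ext {Z : Type u} [AddCommGroup Z] [Module (K ⊗[k] A) Z]
    {f g : BC k K M →ₗ[K ⊗[k] A] Z}
    (h : ∀ m, f (toBC k K M (1 ⊗ₜ[k] m)) = g (toBC k K M (1 ⊗ₜ[k] m))) : f = g := by
  refine LinearMap.ext fun x => ?_
  induction x using bc_induction k K with
  | h0 => rw [map_zero, map_zero]
  | h1 c m => rw [toBC_eq_smul k K (A := A), map_smul, map_smul, h]
  | h2 x y hx hy => rw [map_add, map_add, hx, hy]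

lemma bcMap_injective_iff (f : M →ₗ[A] N) : Injective (bcMap k K f) ↔ Injective f :=
  Module.FaithfullyFlat.lTensor_injective_iff_injective k K (f.restrictScalars k)

/-- Base change commutes with cokernels. -/
lemma bc_coker (f : M →ₗ[A] N) (g : N →ₗ[A] P) (hg : Surjective g)
    (he : ∀ y, g y = 0 ↔ y ∈ Set.range f) :
    Nonempty (BC k K P ≃ₗ[K ⊗[k] A] (BC k K N ⧸ LinearMap.range (bcMap k K f))) := by
  have hg' : Surjective (g.restrictScalars k) := hg
  have hs' := LinearMap.lTensor_surjective K hg'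
  have hs : Surjective (bcMap k K g) := hs'
  have he' : Function.Exact (f.restrictScalars k) (g.restrictScalars k) := he
  have hx := lTensor_exact K he' hg'
  have hk : LinearMap.range (bcMap k K f) = LinearMap.ker (bcMap k K g) := by
    ext x
    exact (hx x).symm
  exact ⟨((Submodule.quotEquivOfEq _ _ hk).trans
    (LinearMap.quotKerEquivOfSurjective _ hs)).symm⟩

/-- Base change commutes with cokernels. -/
lemma bc_quot (f : M →ₗ[A] N) :
    Nonempty (BC k K (N ⧸ LinearMap.range f) ≃ₗ[K ⊗[k] A]
      (BC k K N ⧸ LinearMap.range (bcMap k K f))) :=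
  bc_coker k K f (LinearMap.range f).mkQ (Submodule.mkQ_surjective _) fun y => by simp

lemma inAdd_bc (m : ℕ) (Q : Type u) [AddCommGroup Q] [Module k Q] [Module A Q]
    [SMulCommClass A k Q] [IsScalarTower k A Q] :
    InAdd (K ⊗[k] A) (BC k K Q) (BC k K (Fin m → Q)) := by
  refine ⟨m, LinearMap.pi fun j => bcMap k K (LinearMap.proj (R := A) j),
    ∑ j, bcMap k K (LinearMap.single A (fun _ => Q) j) ∘ₗ LinearMap.proj j, fun x => ?_⟩
  revert x
  refine LinearMap.congr_fun (f := _ ∘ₗ _) (g := LinearMap.id) (big_ext k K fun q => ?_)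
  simp only [LinearMap.comp_apply, LinearMap.sum_apply, LinearMap.proj_apply,
    LinearMap.pi_apply, bcMap_tmul, LinearMap.id_apply]
  show ∑ j, (1 : K) ⊗ₜ[k] (LinearMap.single A (fun _ => Q) j) (q j) = (1 : K) ⊗ₜ[k] q
  rw [← TensorProduct.tmul_sum]
  congr 1
  exact Finset.univ_sum_single q

/-- Homomorphisms between base changes are combinations of base changed homomorphisms. -/
lemma hom_bc [Module.Finite A M] (g : BC k K M →ₗ[K ⊗[k] A] BC k K N) :
    ∃ (ι : Type u) (s : Finset ι) (c : ι → K) (G : ι → (M →ₗ[A] N)),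
      g = ∑ i ∈ s, scal k K N (c i) ∘ₗ bcMap k K (G i) := by
  classical
  let B := Module.Free.chooseBasis k K
  let E : K ⊗[k] N ≃ₗ[k] (_ →₀ N) := TensorProduct.equivFinsuppOfBasisLeft B
  have hE : ∀ (a : A) (x : BC k K N) i, E (a • x) i = a • E x i := by
    intro a x i
    induction x using bc_induction k K with
    | h0 =>
      rw [smul_zero]
      show E 0 i = a • E 0 i
      simp
    | h1 c m =>
      rw [bc_smul_tmul]
      show E (c ⊗ₜ (a • m)) i = a • E (c ⊗ₜ m) i
      simp only [E, TensorProduct.equivFinsuppOfBasisLeft_apply_tmul_apply]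
      exact (smul_comm a _ m).symm
    | h2 x y hx hy =>
      have h3 : ∀ x y : BC k K N, E (x + y) = E x + E y := fun x y => E.map_add x y
      rw [smul_add, h3, h3, Finsupp.add_apply, Finsupp.add_apply, hx, hy, smul_add]
  have hga : ∀ (a : A) (m : M), g (toBC k K M (1 ⊗ₜ[k] (a • m))) =
      a • g (toBC k K M (1 ⊗ₜ[k] m)) := by
    intro a m
    have h4 : toBC k K M (1 ⊗ₜ[k] (a • m)) =
      ((1 : K) ⊗ₜ[k] a : K ⊗[k] A) • toBC k K M (1 ⊗ₜ[k] m) := by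
      rw [bc_big_smul, mul_one]
    rw [h4, map_smul]
    exact one_smul K _
  let G : Module.Free.ChooseBasisIndex k K → (M →ₗ[A] N) := fun i =>
    { toFun := fun m => E (g (toBC k K M (1 ⊗ₜ[k] m))) i
      map_add' := fun x y => by
        have h5 : toBC k K M (1 ⊗ₜ[k] (x + y)) =
          toBC k K M (1 ⊗ₜ[k] x) + toBC k K M (1 ⊗ₜ[k] y) := TensorProduct.tmul_add _ _ _
        rw [h5, map_add]
        exact DFunLike.congr_fun (E.map_add _ _) i
      map_smul' := fun a x => by
        rw [hga, hE]; rfl }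
  obtain ⟨S, hS⟩ := Module.Finite.fg_top (R := A) (M := M)
  let s : Finset (Module.Free.ChooseBasisIndex k K) :=
    S.biUnion fun m => (E (g (toBC k K M (1 ⊗ₜ[k] m)))).support
  have hG : ∀ i ∉ s, G i = 0 := by
    intro i hi
    refine LinearMap.ext_on (s := (S : Set M)) hS fun m hm => ?_
    by_contra hne
    exact hi (Finset.mem_biUnion.2 ⟨m, hm, Finsupp.mem_support_iff.2 hne⟩)
  refine ⟨_, s, B, G, big_ext k K fun m => ?_⟩
  simp only [LinearMap.sum_apply, LinearMap.comp_apply, bcMap_tmul, scal_apply]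
  have h6 : g (toBC k K M (1 ⊗ₜ[k] m)) = E.symm (E (g (toBC k K M (1 ⊗ₜ[k] m)))) :=
    (E.symm_apply_apply _).symm
  rw [h6]
  have h7 := TensorProduct.equivFinsuppOfBasisLeft_symm_apply B
    (E (g (toBC k K M (1 ⊗ₜ[k] m))))
  refine h7.trans ?_
  have hsub : (E (g (toBC k K M (1 ⊗ₜ[k] m)))).support ⊆ s := by
    intro i hi
    by_contra hne
    exact Finsupp.mem_support_iff.1 hi (LinearMap.congr_fun (hG i hne) m)
  rw [Finsupp.sum_of_support_subset _ hsub _ (fun i _ => TensorProduct.tmul_zero _ _)]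
  refine Finset.sum_congr rfl fun i _ => ?_
  rw [bc_s_smul, TensorProduct.smul_tmul', smul_eq_mul, mul_one]
  rfl

lemma app_bc [Module.Finite A M] (Q : Type u) [AddCommGroup Q] [Module k Q] [Module A Q]
    [SMulCommClass A k Q] [IsScalarTower k A Q] (f : M →ₗ[A] N) (hf : App A Q f) :
    App (K ⊗[k] A) (BC k K Q) (bcMap k K f) := by
  intro g
  obtain ⟨ι, s, c, G, rfl⟩ := hom_bc k K g
  choose H hH using fun i => hf (G i)
  refine ⟨∑ i ∈ s, scal k K Q (c i) ∘ₗ bcMap k K (H i), ?_⟩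
  refine LinearMap.congr_fun (f := _ ∘ₗ _) (big_ext k K fun m => ?_)
  simp only [LinearMap.sum_apply, LinearMap.comp_apply, bcMap_tmul, hH]

lemma exists_app [Module.Finite k A] [Module.Finite A M] (Q : Type u) [AddCommGroup Q]
    [Module k Q] [Module A Q]
    [SMulCommClass A k Q] [IsScalarTower k A Q] [Module.Finite A Q] :
    ∃ (m : ℕ) (f : M →ₗ[A] (Fin m → Q)), App A Q f := by
  have : Module.Finite k M := Module.Finite.trans A M
  have : Module.Finite k Q := Module.Finite.trans A Q
  have : Module.Finite k (M →ₗ[A] Q) :=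
    Module.Finite.of_injective (LinearMap.restrictScalarsₗ k A M Q k)
      (LinearMap.restrictScalars_injective k)
  obtain ⟨m, v, hv⟩ := Module.Finite.exists_fin (R := k) (M := M →ₗ[A] Q)
  refine ⟨m, LinearMap.pi v, fun g => ?_⟩
  have hg : g ∈ Submodule.span k (Set.range v) := hv ▸ Submodule.mem_top
  obtain ⟨c, rfl⟩ := (Submodule.mem_span_range_iff_exists_fun k).1 hg
  refine ⟨∑ j, c j • LinearMap.proj j, fun x => ?_⟩
  simp

lemma domdimGE_bc [Module.Finite k A] (Q : Type u) [AddCommGroup Q] [Module k Q] [Module A Q]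
    [SMulCommClass A k Q] [IsScalarTower k A Q] [Module.Finite A Q] (n : ℕ) :
    ∀ (M : Type u) [AddCommGroup M] [Module k M] [Module A M]
      [SMulCommClass A k M] [IsScalarTower k A M] [Module.Finite A M],
    DomdimGE K (K ⊗[k] A) (BC k K Q) n (ModuleCat.of (K ⊗[k] A) (BC k K M)) ↔
      DomdimGE k A Q n (ModuleCat.of A M) := by
  induction n with
  | zero => intros; exact Iff.rfl
  | succ n ih =>
    intro M _ _ _ _ _ _
    obtain ⟨m, f, hf⟩ := exists_app k (A := A) (M := M) Q
    rw [domdimGE_succ_iff k n f hf ⟨m, LinearMap.id, LinearMap.id, fun _ => rfl⟩,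
      domdimGE_succ_iff K n (bcMap k K f) (app_bc k K Q f hf) (inAdd_bc k K m Q),
      bcMap_injective_iff, ← ih ((Fin m → Q) ⧸ LinearMap.range f)]
    obtain ⟨e⟩ := bc_quot k K f
    rw [domdimGE_congr K n e]

end Base

end RelDomAux

section Stmt16

variable (k : Type u) [Field k]
variable (A : Type u) [Ring A] [Algebra k A] [Module.Finite k A]
variable (Q : Type u) [AddCommGroup Q] [Module k Q] [Module A Q]
  [IsScalarTower k A Q] [SMulCommClass A k Q] [SMulCommClass k A Q]
  [Module.Finite A Q]
variable (M : Type u) [AddCommGroup M] [Module k M] [Module A M]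
  [IsScalarTower k A M] [SMulCommClass A k M] [SMulCommClass k A M]
  [Module.Finite A M]

/-- Relative dominant dimension is stable under extension of
scalars to the algebraic closure:
`(K ⊗ₖ Q)-domdim_{K ⊗ₖ A} (K ⊗ₖ M) = Q-domdim_A M` with `K` the algebraic
closure of `k`. -/
theorem stmt_16 :
    Domdim (AlgebraicClosure k) ((AlgebraicClosure k) ⊗[k] A)
        (BC k (AlgebraicClosure k) Q)
        (ModuleCat.of ((AlgebraicClosure k) ⊗[k] A) (BC k (AlgebraicClosure k) M)) =
      Domdim k A Q (ModuleCat.of A M) := by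
  simp only [Domdim, RelDomAux.domdimGE_bc]

end Stmt16
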